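/- Let a, b > 0 with 2a < b ≤ 1 and α > 1. Then for Lebesgue almost every y ∈ [0,1]: for every A ⊆ ℕ with positive upper Banach density, there exist infinitely many pairs (n,m) ∈ ℕ² such that ⟨α^{m^b} y⟩ < m^{-a} and both n ∈ A and n + m ∈ A. -/

import Mathlib

open MeasureTheory Filter

/-- Distance from a real number to the nearest integer. -/
noncomputable def distNearestInt (x : ℝ) : ℝ := |x - (round x : ℝ)|

/-- The number of pairs in `B` with difference `h`. -/
noncomputable def corr (B : Finset ℤ) (h : ℤ) : ℝ := ((B.filter fun u => u + h ∈ B).card : ℝ)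

theorem corr_nonneg (B : Finset ℤ) (h : ℤ) : 0 ≤ corr B h := Nat.cast_nonneg _

theorem corr_le_card (B : Finset ℤ) (h : ℤ) : corr B h ≤ B.card := by
  unfold corr
  exact_mod_cast Finset.card_filter_le _ _

theorem corr_eq_sum (B : Finset ℤ) (h : ℤ) :
    corr B h = ∑ u ∈ B, if u + h ∈ B then (1 : ℝ) else 0 := by
  simp [corr, Finset.sum_boole]

theorem sum_mul_corr_sq_le (B I : Finset ℤ) (x : ℤ → ℝ) :
    (∑ m ∈ I, x m * corr B m) ^ 2 ≤
      B.card * ∑ m ∈ I, ∑ m' ∈ I, x m * x m' * corr B (m' - m) := by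
  classical
  set f : ℤ → ℝ := fun u => if u ∈ B then 1 else 0 with hf
  set S : ℤ → ℝ := fun n => ∑ m ∈ I, x m * f (n + m) with hS
  set T : Finset ℤ := B ∪ (B ×ˢ I).image (fun p => p.1 - p.2) with hT
  have h1 : ∑ m ∈ I, x m * corr B m = ∑ n ∈ B, S n := by
    simp only [hS, corr_eq_sum, Finset.mul_sum]
    rw [Finset.sum_comm]
  have h2 : (∑ n ∈ B, S n) ^ 2 ≤ B.card * ∑ n ∈ B, S n ^ 2 := sq_sum_le_card_mul_sum_sq
  have h3 : ∑ n ∈ B, S n ^ 2 ≤ ∑ n ∈ T, S n ^ 2 :=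
    Finset.sum_le_sum_of_subset_of_nonneg Finset.subset_union_left (fun _ _ _ => sq_nonneg _)
  have h4 : ∀ m ∈ I, ∀ m' : ℤ, ∑ n ∈ T, f (n + m) * f (n + m') = corr B (m' - m) := by
    intro m hm m'
    rw [corr_eq_sum]
    have hinj : Function.Injective (fun u : ℤ => u - m) := sub_left_injective
    have hsub : B.image (fun u => u - m) ⊆ T := by
      intro n hn
      obtain ⟨u, hu, rfl⟩ := Finset.mem_image.1 hn
      exact Finset.mem_union_right _ (Finset.mem_image.2 ⟨(u, m), by simp [hu, hm], rfl⟩)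
    rw [← Finset.sum_subset hsub, Finset.sum_image (fun _ _ _ _ h => hinj h)]
    · refine Finset.sum_congr rfl fun u hu => ?_
      have : u - m + m' = u + (m' - m) := by ring
      simp [hf, hu, this]
    · intro n _ hn
      have : n + m ∉ B := fun h => hn (Finset.mem_image.2 ⟨n + m, h, by ring⟩)
      simp [hf, this]
  have h5 : ∑ n ∈ T, S n ^ 2 = ∑ m ∈ I, ∑ m' ∈ I, x m * x m' * corr B (m' - m) := by
    have : ∀ n, S n ^ 2 = ∑ m ∈ I, ∑ m' ∈ I, x m * x m' * (f (n + m) * f (n + m')) := by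
      intro n
      rw [sq, hS, Finset.sum_mul_sum]
      refine Finset.sum_congr rfl fun m _ => Finset.sum_congr rfl fun m' _ => by ring
    simp_rw [this]
    rw [Finset.sum_comm]
    refine Finset.sum_congr rfl fun m hm => ?_
    rw [Finset.sum_comm]
    refine Finset.sum_congr rfl fun m' _ => ?_
    rw [← Finset.mul_sum, h4 m hm]
  rw [h1, ← h5]
  exact h2.trans (mul_le_mul_of_nonneg_left h3 (Nat.cast_nonneg _))

theorem sum_mul_corr_pow_four_le (B : Finset ℤ) (N : ℕ) (x : ℤ → ℝ)
    (hx : ∀ m ∉ Finset.Ioc (0 : ℤ) N, x m = 0) :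
    (∑ m ∈ Finset.Ioc (0 : ℤ) N, x m * corr B m) ^ 4 ≤
      (B.card : ℝ) ^ 4 * (2 * N * ∑ h ∈ Finset.Ioo (-N : ℤ) N,
        (∑ m ∈ Finset.Ioc (0 : ℤ) N, x m * x (m + h)) ^ 2) := by
  set I := Finset.Ioc (0 : ℤ) N with hI
  set J := Finset.Ioo (-N : ℤ) N with hJ
  set γ : ℤ → ℝ := fun h => ∑ m ∈ I, x m * x (m + h) with hγ
  have h1 : ∑ m ∈ I, ∑ m' ∈ I, x m * x m' * corr B (m' - m) = ∑ h ∈ J, corr B h * γ h := by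
    simp only [hγ, Finset.mul_sum]
    rw [Finset.sum_comm (s := J)]
    refine Finset.sum_congr rfl fun m hm => ?_
    have hinj : Function.Injective (fun u : ℤ => u - m) := sub_left_injective
    have hsub : I.image (fun u => u - m) ⊆ J := by
      intro n hn
      obtain ⟨u, hu, rfl⟩ := Finset.mem_image.1 hn
      simp only [hI, hJ, Finset.mem_Ioc, Finset.mem_Ioo] at *
      omega
    rw [← Finset.sum_subset hsub, Finset.sum_image (fun _ _ _ _ h => hinj h)]
    · refine Finset.sum_congr rfl fun u hu => ?_
      rw [show m + (u - m) = u by ring]; ring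
    · intro h _ hn
      have : m + h ∉ I := fun h' => hn (Finset.mem_image.2 ⟨m + h, h', by ring⟩)
      rw [hx _ this]; ring
  have h2 := sum_mul_corr_sq_le B I x
  rw [h1] at h2
  have h3 : (∑ h ∈ J, corr B h * γ h) ^ 2 ≤ (∑ h ∈ J, corr B h ^ 2) * ∑ h ∈ J, γ h ^ 2 :=
    Finset.sum_mul_sq_le_sq_mul_sq J _ _
  have h4 : ∑ h ∈ J, corr B h ^ 2 ≤ 2 * N * (B.card : ℝ) ^ 2 := by
    have : ∑ h ∈ J, corr B h ^ 2 ≤ J.card • (B.card : ℝ) ^ 2 :=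
      Finset.sum_le_card_nsmul _ _ _ fun h _ =>
        pow_le_pow_left₀ (corr_nonneg B h) (corr_le_card B h) 2
    have hJc : (J.card : ℝ) ≤ 2 * N := by
      have : J.card ≤ 2 * N := by simp [hJ]; omega
      exact_mod_cast this
    rw [nsmul_eq_mul] at this
    exact this.trans (by gcongr)
  have h5 : 0 ≤ ∑ h ∈ J, γ h ^ 2 := Finset.sum_nonneg fun _ _ => sq_nonneg _
  calc (∑ m ∈ I, x m * corr B m) ^ 4 = ((∑ m ∈ I, x m * corr B m) ^ 2) ^ 2 := by ring
    _ ≤ (B.card * ∑ h ∈ J, corr B h * γ h) ^ 2 := pow_le_pow_left₀ (sq_nonneg _) h2 2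
    _ = (B.card : ℝ) ^ 2 * (∑ h ∈ J, corr B h * γ h) ^ 2 := by ring
    _ ≤ (B.card : ℝ) ^ 2 * ((2 * N * (B.card : ℝ) ^ 2) * ∑ h ∈ J, γ h ^ 2) := by
        gcongr
        exact h3.trans (by gcongr)
    _ = _ := by ring

theorem mul_div_three_le_of_sq_le {c d q v m n : ℝ} (hc : 0 ≤ c) (hv : 0 ≤ v) (hn : 0 < n)
    (hm : 0 < m) (hd : d * m ≤ c) (hcs : c ^ 2 ≤ q * v) (hq : q * n ≤ 3 * m) :
    c * (d * n / 3) ≤ v := by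
  have k1 : c ^ 2 * n ≤ 3 * m * v := by
    calc c ^ 2 * n ≤ q * v * n := by gcongr
      _ = q * n * v := by ring
      _ ≤ _ := by gcongr
  have k2 : c * (d * m) * n ≤ c ^ 2 * n := by
    rw [sq]; gcongr
  have k3 : m * (c * (d * n / 3)) ≤ m * v := by linarith
  exact le_of_mul_le_mul_left k3 hm

theorem card_mul_le_card_add_sum_corr (B : Finset ℤ) (k : ℤ) (M N : ℕ) (d : ℝ) (hN : 0 < N)
    (hNM : N ≤ M) (hB : B ⊆ Finset.Ioc k (k + M)) (hd : d * M ≤ B.card) :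
    B.card * (d * N / 3) ≤ B.card + 2 * ∑ m ∈ Finset.Ioc (0 : ℤ) N, corr B m := by
  classical
  have hN' : (0 : ℤ) < N := by exact_mod_cast hN
  set Q := Finset.Icc (k / N) ((k + M) / N) with hQ
  have hmaps : ∀ u ∈ B, u / (N : ℤ) ∈ Q := by
    intro u hu
    have := Finset.mem_Ioc.1 (hB hu)
    exact Finset.mem_Icc.2 ⟨Int.ediv_le_ediv hN' this.1.le, Int.ediv_le_ediv hN' this.2⟩
  have hQc : (Q.card : ℝ) * N ≤ 3 * M := by
    have h1 : (k + M) / N * N ≤ k + M := Int.ediv_mul_le _ hN'.ne'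
    have h2 : k < (k / N + 1) * N := Int.lt_ediv_add_one_mul_self _ hN'
    have h0 : k / N ≤ (k + M) / N := Int.ediv_le_ediv hN' (by omega)
    have h3 : ((Q.card : ℕ) : ℤ) = (k + M) / N + 1 - k / N := by
      rw [hQ, Int.card_Icc, Int.toNat_of_nonneg (by omega)]
    have h4 : ((Q.card : ℕ) : ℤ) * N ≤ 3 * M := by
      rw [h3]
      have : (N : ℤ) ≤ M := by exact_mod_cast hNM
      nlinarith
    exact_mod_cast h4
  set b : ℤ → ℕ := fun q => (B.filter fun u => u / (N : ℤ) = q).card with hb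
  have hsum : (B.card : ℝ) = ∑ q ∈ Q, (b q : ℝ) := by
    exact_mod_cast Finset.card_eq_sum_card_fiberwise hmaps
  have hcs : (B.card : ℝ) ^ 2 ≤ Q.card * ∑ q ∈ Q, (b q : ℝ) ^ 2 := by
    rw [hsum]; exact sq_sum_le_card_mul_sum_sq
  set P := (B ×ˢ B).filter fun p => p.1 / (N : ℤ) = p.2 / N with hP
  have hPc : ∑ q ∈ Q, (b q : ℝ) ^ 2 = P.card := by
    have : P.card = ∑ q ∈ Q, (P.filter fun p => p.1 / (N : ℤ) = q).card :=
      Finset.card_eq_sum_card_fiberwise (f := fun p : ℤ × ℤ => p.1 / (N : ℤ)) (by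
        intro p hp
        have := Finset.mem_filter.1 hp
        exact hmaps _ (Finset.mem_product.1 this.1).1)
    rw [this]
    push_cast
    refine Finset.sum_congr rfl fun q _ => ?_
    rw [sq, ← Nat.cast_mul, hb, ← Finset.card_product]
    congr 2
    ext ⟨u, v⟩
    simp only [hP, Finset.mem_product, Finset.mem_filter]
    constructor
    · rintro ⟨⟨h1, h2⟩, h3, h4⟩
      exact ⟨⟨⟨h1, h3⟩, h2.trans h4.symm⟩, h2⟩
    · rintro ⟨⟨⟨h1, h3⟩, h4⟩, h2⟩
      exact ⟨⟨h1, h2⟩, h3, h4.symm.trans h2⟩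
  have hcorr : ∀ m, corr B m = (((B ×ˢ B).filter fun p => p.2 - p.1 = m).card : ℝ) := by
    intro m
    unfold corr
    congr 1
    refine Finset.card_bij (fun u _ => (u, u + m)) ?_ ?_ ?_
    · intro u hu
      have := Finset.mem_filter.1 hu
      simp [this.1, this.2]
    · intro u _ v _ h
      exact (Prod.ext_iff.1 h).1
    · rintro ⟨u, v⟩ h
      simp only [Finset.mem_filter, Finset.mem_product] at h
      obtain ⟨⟨h1, h2⟩, h3⟩ := h
      have h4 : u + m = v := by omega
      exact ⟨u, by simp [h1, h4, h2], by simp [h4]⟩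
  set R := (B ×ˢ B).filter fun p => p.2 - p.1 ∈ Finset.Ioc (0 : ℤ) N with hR
  have hRc : (R.card : ℝ) = ∑ m ∈ Finset.Ioc (0 : ℤ) N, corr B m := by
    have : R.card = ∑ m ∈ Finset.Ioc (0 : ℤ) N, (R.filter fun p => p.2 - p.1 = m).card :=
      Finset.card_eq_sum_card_fiberwise (f := fun p : ℤ × ℤ => p.2 - p.1)
        fun p hp => (Finset.mem_filter.1 hp).2
    rw [this]
    push_cast
    refine Finset.sum_congr rfl fun m hm => ?_
    rw [hcorr, hR, Finset.filter_filter]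
    congr 2
    ext p
    simp only [Finset.mem_filter]
    constructor
    · rintro ⟨h1, h2, h3⟩; exact ⟨h1, h3⟩
    · rintro ⟨h1, h3⟩; exact ⟨h1, h3 ▸ hm, h3⟩
  have hsub : P ⊆ B.diag ∪ (R ∪ R.image Prod.swap) := by
    rintro ⟨u, v⟩ h
    simp only [hP, Finset.mem_filter, Finset.mem_product] at h
    obtain ⟨⟨h1, h2⟩, h3⟩ := h
    have e1 := Int.ediv_mul_le u hN'.ne'
    have e2 := Int.lt_ediv_add_one_mul_self u hN'
    have e3 := Int.ediv_mul_le v hN'.ne'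
    have e4 := Int.lt_ediv_add_one_mul_self v hN'
    rw [h3] at e1 e2
    rw [add_mul, one_mul] at e2 e4
    simp only [Finset.mem_union, Finset.mem_diag, Finset.mem_image, hR, Finset.mem_filter,
      Finset.mem_product, Finset.mem_Ioc, Prod.exists, Prod.swap_prod_mk, Prod.mk.injEq]
    rcases lt_trichotomy u v with h | h | h
    · right; left; exact ⟨⟨h1, h2⟩, by omega, by omega⟩
    · left; exact ⟨h1, h⟩
    · right; right; exact ⟨v, u, ⟨⟨h2, h1⟩, by omega, by omega⟩, rfl, rfl⟩
  have hPle : (P.card : ℝ) ≤ B.card + 2 * R.card := by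
    have h1 := Finset.card_le_card hsub
    have h2 := Finset.card_union_le B.diag (R ∪ R.image Prod.swap)
    have h3 := Finset.card_union_le R (R.image Prod.swap)
    have h4 : (R.image Prod.swap).card ≤ R.card := Finset.card_image_le
    have h5 := B.diag_card
    have : P.card ≤ B.card + 2 * R.card := by omega
    exact_mod_cast this
  rw [← hRc]
  refine le_trans ?_ hPle
  rw [← hPc]
  exact mul_div_three_le_of_sq_le (Nat.cast_nonneg _) (Finset.sum_nonneg fun _ _ => sq_nonneg _)
    (by exact_mod_cast hN) (by exact_mod_cast hN.trans_le hNM) hd hcs hQc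

/-- `C¹` functions bounded by `1` whose derivative is bounded by `Q`. -/
def Tame (Q : ℝ) (G : ℝ → ℝ) : Prop :=
  ContDiff ℝ 1 G ∧ (∀ y, |G y| ≤ 1) ∧ ∀ y, |deriv G y| ≤ Q

theorem Tame.continuous {Q : ℝ} {G : ℝ → ℝ} (h : Tame Q G) : Continuous G := h.1.continuous

theorem Tame.differentiable {Q : ℝ} {G : ℝ → ℝ} (h : Tame Q G) : Differentiable ℝ G :=
  h.1.differentiable one_ne_zero

theorem tame_one : Tame 0 fun _ => 1 :=
  ⟨contDiff_const, fun _ => by simp, fun _ => by simp⟩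

theorem Tame.mul {Q Q' : ℝ} {F G : ℝ → ℝ} (hF : Tame Q F) (hG : Tame Q' G) :
    Tame (Q + Q') fun y => F y * G y := by
  refine ⟨hF.1.mul hG.1, fun y => ?_, fun y => ?_⟩
  · rw [abs_mul]
    exact mul_le_one₀ (hF.2.1 y) (abs_nonneg _) (hG.2.1 y)
  · have h : HasDerivAt (fun y => F y * G y) (deriv F y * G y + F y * deriv G y) y :=
      (hF.differentiable y).hasDerivAt.mul (hG.differentiable y).hasDerivAt
    rw [h.deriv]
    refine (abs_add_le _ _).trans ?_
    rw [abs_mul, abs_mul]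
    have h1 := hF.2.1 y
    have h2 := hG.2.1 y
    have h3 := hF.2.2 y
    have h4 := hG.2.2 y
    nlinarith [abs_nonneg (F y), abs_nonneg (G y), abs_nonneg (deriv F y), abs_nonneg (deriv G y)]

theorem Tame.comp_mul_left {Q l : ℝ} {G : ℝ → ℝ} (h : Tame Q G) (hl : 0 ≤ l) :
    Tame (Q * l) fun y => G (l * y) := by
  refine ⟨h.1.comp (contDiff_const.mul contDiff_id), fun y => h.2.1 _, fun y => ?_⟩
  have h1 : HasDerivAt (fun y => G (l * y)) (deriv G (l * y) * (l * 1)) y :=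
    HasDerivAt.comp (h₂ := G) y (h.differentiable _).hasDerivAt ((hasDerivAt_id y).const_mul l)
  rw [h1.deriv, mul_one, abs_mul, abs_of_nonneg hl]
  exact mul_le_mul_of_nonneg_right (h.2.2 _) hl

/-- Primitives of mean-zero periodic functions are bounded. -/
theorem abs_primitive_le_one {g : ℝ → ℝ} (hg : Continuous g) (hper : Function.Periodic g 1)
    (hbd : ∀ t, |g t| ≤ 1) (hmean : ∫ t in (0 : ℝ)..1, g t = 0) (t : ℝ) :
    |∫ s in (0 : ℝ)..t, g s| ≤ 1 := by
  have hp : Function.Periodic (fun t => ∫ s in (0 : ℝ)..t, g s) 1 := by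
    intro t
    have h := hper.intervalIntegral_add_eq t 0
    rw [zero_add, hmean] at h
    have := intervalIntegral.integral_add_adjacent_intervals
      (hg.intervalIntegrable (μ := volume) 0 t) (hg.intervalIntegrable t (t + 1))
    simp only
    rw [← this, h, add_zero]
  have h1 : ∫ s in (0 : ℝ)..t, g s = ∫ s in (0 : ℝ)..(Int.fract t), g s := by
    have := hp.sub_int_mul_eq (x := t) ⌊t⌋
    simp only [mul_one] at this
    rw [← this, Int.fract]
  rw [h1]
  have h2 := intervalIntegral.norm_integral_le_of_norm_le_const (a := 0) (b := Int.fract t)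
    (f := g) (C := 1) fun s _ => hbd s
  rw [sub_zero, one_mul, abs_of_nonneg (Int.fract_nonneg t)] at h2
  exact h2.trans (Int.fract_lt_one t).le

theorem abs_integral_mul_comp_le {Q l : ℝ} {G g : ℝ → ℝ} (hG : Tame Q G) (hg : Continuous g)
    (hper : Function.Periodic g 1) (hbd : ∀ t, |g t| ≤ 1)
    (hmean : ∫ t in (0 : ℝ)..1, g t = 0) (hl : 0 < l) :
    |∫ y in (0 : ℝ)..1, G y * g (l * y)| ≤ (2 + Q) / l := by
  set P : ℝ → ℝ := fun t => ∫ s in (0 : ℝ)..t, g s with hP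
  have hPd : ∀ t, HasDerivAt P (g t) t := fun t =>
    intervalIntegral.integral_hasDerivAt_right (hg.intervalIntegrable _ _)
      hg.stronglyMeasurable.stronglyMeasurableAtFilter hg.continuousAt
  have hPc : Continuous P := continuous_iff_continuousAt.2 fun t => (hPd t).continuousAt
  have hPb : ∀ t, |P t| ≤ 1 := abs_primitive_le_one hg hper hbd hmean
  have hv : ∀ y, HasDerivAt (fun y => P (l * y) / l) (g (l * y)) y := by
    intro y
    have h1 : HasDerivAt (fun y => P (l * y)) (g (l * y) * (l * 1)) y :=
      HasDerivAt.comp (h₂ := P) y (hPd _) ((hasDerivAt_id y).const_mul l)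
    have h2 := h1.div_const l
    rwa [mul_one, mul_div_cancel_right₀ _ hl.ne'] at h2
  have hdc : Continuous (deriv G) := hG.1.continuous_deriv le_rfl
  have key := intervalIntegral.integral_mul_deriv_eq_deriv_mul (a := 0) (b := 1)
    (fun y _ => (hG.differentiable y).hasDerivAt) (fun y _ => hv y)
    (hdc.intervalIntegrable _ _)
    ((hg.comp (continuous_const.mul continuous_id)).intervalIntegrable _ _)
  rw [key]
  have hb : ∀ y, |P (l * y) / l| ≤ 1 / l := by
    intro y
    rw [abs_div, abs_of_pos hl]
    exact div_le_div_of_nonneg_right (hPb _) hl.le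
  have h1 : ∀ y, |G y * (P (l * y) / l)| ≤ 1 / l := by
    intro y
    rw [abs_mul]
    calc _ ≤ 1 * (1 / l) := mul_le_mul (hG.2.1 y) (hb y) (abs_nonneg _) zero_le_one
      _ = _ := one_mul _
  have h2 : |∫ y in (0 : ℝ)..1, deriv G y * (P (l * y) / l)| ≤ Q * (1 / l) := by
    have := intervalIntegral.norm_integral_le_of_norm_le_const (a := 0) (b := 1)
      (f := fun y => deriv G y * (P (l * y) / l)) (C := Q * (1 / l)) fun y _ => by
        rw [Real.norm_eq_abs, abs_mul]
        exact mul_le_mul (hG.2.2 y) (hb y) (abs_nonneg _) ((abs_nonneg _).trans (hG.2.2 y))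
    simpa using this
  calc _ ≤ |G 1 * (P (l * 1) / l)| + |G 0 * (P (l * 0) / l)|
        + |∫ y in (0 : ℝ)..1, deriv G y * (P (l * y) / l)| := by
        refine (abs_sub _ _).trans ?_
        gcongr
        exact abs_sub _ _
    _ ≤ 1 / l + 1 / l + Q * (1 / l) := by
        gcongr
        · exact h1 1
        · exact h1 0
    _ = _ := by ring

theorem hasDerivAt_max_zero_sq (x : ℝ) :
    HasDerivAt (fun x : ℝ => (max 0 x) ^ 2) (2 * max 0 x) x := by
  rcases lt_trichotomy x 0 with h | h | h
  · have : (fun x : ℝ => (max 0 x) ^ 2) =ᶠ[nhds x] fun _ => 0 := by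
      filter_upwards [Iio_mem_nhds h] with z hz
      simp [max_eq_left (Set.mem_Iio.1 hz).le]
    rw [max_eq_left h.le, mul_zero]
    exact (hasDerivAt_const x (0 : ℝ)).congr_of_eventuallyEq this
  · subst h
    rw [hasDerivAt_iff_isLittleO_nhds_zero]
    simp only [max_self, mul_zero, smul_eq_mul, zero_add, ne_eq, OfNat.ofNat_ne_zero,
      not_false_eq_true, zero_pow, sub_zero]
    have h1 : (fun z : ℝ => (max 0 z) ^ 2) =O[nhds 0] fun z : ℝ => z ^ 2 := by
      refine Asymptotics.isBigO_of_le _ fun z => ?_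
      rw [norm_pow, norm_pow]
      gcongr
      rw [Real.norm_eq_abs, Real.norm_eq_abs]
      rcases le_total 0 z with hz | hz
      · rw [max_eq_right hz]
      · rw [max_eq_left hz]; simp
    exact h1.trans_isLittleO (Asymptotics.isLittleO_pow_id one_lt_two)
  · have : (fun x : ℝ => (max 0 x) ^ 2) =ᶠ[nhds x] fun x => x ^ 2 := by
      filter_upwards [Ioi_mem_nhds h] with z hz
      simp [max_eq_right (Set.mem_Ioi.1 hz).le]
    rw [max_eq_right h.le]
    refine HasDerivAt.congr_of_eventuallyEq ?_ this
    simpa using hasDerivAt_pow 2 x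

/-- A nonnegative `1`-periodic `C¹` function which vanishes off the `δ`-neighbourhood of `ℤ`. -/
noncomputable def bump (δ t : ℝ) : ℝ := (max 0 (1 - Real.sin (Real.pi * t) ^ 2 / δ ^ 2)) ^ 2

theorem bump_nonneg (δ t : ℝ) : 0 ≤ bump δ t := sq_nonneg _

theorem bump_le_one (δ t : ℝ) : bump δ t ≤ 1 := by
  unfold bump
  refine pow_le_one₀ (le_max_left _ _) (max_le zero_le_one ?_)
  have : 0 ≤ Real.sin (Real.pi * t) ^ 2 / δ ^ 2 := by positivity
  linarith

theorem bump_periodic (δ : ℝ) : Function.Periodic (bump δ) 1 := by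
  intro t
  unfold bump
  rw [mul_add, mul_one, Real.sin_add_pi, neg_sq]

theorem hasDerivAt_bump (δ t : ℝ) :
    HasDerivAt (bump δ) (2 * max 0 (1 - Real.sin (Real.pi * t) ^ 2 / δ ^ 2) *
      (-(2 * Real.sin (Real.pi * t) * (Real.cos (Real.pi * t) * Real.pi) / δ ^ 2))) t := by
  have h1 : HasDerivAt (fun t : ℝ => Real.pi * t) Real.pi t := by
    simpa using (hasDerivAt_id t).const_mul Real.pi
  have h2 : HasDerivAt (fun t : ℝ => 1 - Real.sin (Real.pi * t) ^ 2 / δ ^ 2)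
      (-(2 * Real.sin (Real.pi * t) * (Real.cos (Real.pi * t) * Real.pi) / δ ^ 2)) t := by
    simpa using ((h1.sin.pow 2).div_const (δ ^ 2)).const_sub 1
  exact HasDerivAt.comp (h₂ := fun x : ℝ => (max 0 x) ^ 2) t (hasDerivAt_max_zero_sq _) h2

theorem tame_bump {δ : ℝ} (hδ : 0 < δ) : Tame (16 / δ ^ 2) (bump δ) := by
  refine ⟨?_, fun y => ?_, fun y => ?_⟩
  · rw [contDiff_one_iff_deriv]
    refine ⟨fun t => (hasDerivAt_bump δ t).differentiableAt, ?_⟩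
    rw [funext fun t => (hasDerivAt_bump δ t).deriv]
    fun_prop
  · rw [abs_of_nonneg (bump_nonneg _ _)]
    exact bump_le_one _ _
  · rw [(hasDerivAt_bump δ y).deriv]
    set u := max 0 (1 - Real.sin (Real.pi * y) ^ 2 / δ ^ 2)
    have hu0 : 0 ≤ u := le_max_left _ _
    have hu1 : u ≤ 1 := by
      refine max_le zero_le_one ?_
      have : 0 ≤ Real.sin (Real.pi * y) ^ 2 / δ ^ 2 := by positivity
      linarith
    rw [abs_mul, abs_neg, abs_div, abs_of_nonneg (mul_nonneg zero_le_two hu0),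
      abs_of_pos (pow_pos hδ 2), abs_mul, abs_mul, abs_mul, abs_of_pos Real.pi_pos,
      abs_of_pos (zero_lt_two' ℝ), ← mul_div_assoc]
    gcongr
    have h1 := Real.abs_sin_le_one (Real.pi * y)
    have h2 := Real.abs_cos_le_one (Real.pi * y)
    calc 2 * u * (2 * |Real.sin (Real.pi * y)| * (|Real.cos (Real.pi * y)| * Real.pi))
        ≤ 2 * 1 * (2 * 1 * (1 * 4)) := by
          gcongr
          exact Real.pi_le_four
      _ = 16 := by norm_num

theorem distNearestInt_lt_of_bump_ne_zero {δ t : ℝ} (hδ : 0 < δ) (h : bump δ t ≠ 0) :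
    distNearestInt t < δ := by
  by_contra! hle
  unfold distNearestInt at hle
  apply h
  unfold bump
  set x := t - (round t : ℝ) with hx
  have hx2 : |x| ≤ 1 / 2 := abs_sub_round t
  have hs : Real.sin (Real.pi * t) ^ 2 = Real.sin (Real.pi * |x|) ^ 2 := by
    have h1 : Real.pi * t = Real.pi * x + (round t : ℤ) * Real.pi := by rw [hx]; ring
    rw [h1, Real.sin_add_int_mul_pi]
    have h2 : ((-1 : ℝ) ^ (round t)) ^ 2 = 1 := by
      rcases Int.even_or_odd (round t) with he | ho
      · rw [he.neg_one_zpow]; norm_num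
      · rw [ho.neg_one_zpow]; norm_num
    rw [mul_pow, h2, one_mul]
    rcases abs_choice x with h | h <;> rw [h]
    rw [mul_neg, Real.sin_neg, neg_sq]
  have h3 : 2 * |x| ≤ Real.sin (Real.pi * |x|) := by
    have := Real.mul_le_sin (x := Real.pi * |x|) (by positivity)
      (by nlinarith [Real.pi_pos])
    have h4 : 2 / Real.pi * (Real.pi * |x|) = 2 * |x| := by
      field_simp
    rwa [h4] at this
  have h5 : δ ^ 2 ≤ Real.sin (Real.pi * t) ^ 2 := by
    rw [hs]
    exact pow_le_pow_left₀ hδ.le (by linarith) 2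
  have h6 : 1 ≤ Real.sin (Real.pi * t) ^ 2 / δ ^ 2 := (one_le_div (by positivity)).2 h5
  rw [max_eq_left (by linarith)]
  norm_num

theorem le_integral_bump {δ : ℝ} (hδ : 0 < δ) (hδ1 : δ ≤ 1) :
    δ / 16 ≤ ∫ t in (0 : ℝ)..1, bump δ t := by
  have hc := (tame_bump hδ).continuous
  have h8 : (0 : ℝ) ≤ δ / 8 := by positivity
  have h1 : ∫ t in (0 : ℝ)..(δ / 8), (1 / 2 : ℝ) ≤ ∫ t in (0 : ℝ)..(δ / 8), bump δ t := by
    refine intervalIntegral.integral_mono_on h8 (by simp) (hc.intervalIntegrable _ _) ?_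
    intro t ht
    unfold bump
    have hs0 : 0 ≤ Real.sin (Real.pi * t) :=
      Real.sin_nonneg_of_nonneg_of_le_pi (mul_nonneg Real.pi_pos.le ht.1)
        (by nlinarith [Real.pi_pos, ht.2])
    have hs : Real.sin (Real.pi * t) ≤ δ / 2 := by
      refine (Real.sin_le (mul_nonneg Real.pi_pos.le ht.1)).trans ?_
      calc Real.pi * t ≤ 4 * (δ / 8) := mul_le_mul Real.pi_le_four ht.2 ht.1 (by norm_num)
        _ = _ := by ring
    have h2 : Real.sin (Real.pi * t) ^ 2 / δ ^ 2 ≤ 1 / 4 := by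
      rw [div_le_iff₀ (by positivity)]
      nlinarith
    have h3 : 3 / 4 ≤ max 0 (1 - Real.sin (Real.pi * t) ^ 2 / δ ^ 2) :=
      le_max_of_le_right (by linarith)
    nlinarith
  have h2 : 0 ≤ ∫ t in (δ / 8)..1, bump δ t :=
    intervalIntegral.integral_nonneg (by linarith) fun t _ => bump_nonneg _ _
  have h3 := intervalIntegral.integral_add_adjacent_intervals
    (hc.intervalIntegrable (μ := volume) 0 (δ / 8)) (hc.intervalIntegrable (δ / 8) 1)
  rw [intervalIntegral.integral_const, smul_eq_mul] at h1
  linarith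

theorem integral_bump_le_one {δ : ℝ} (hδ : 0 < δ) : ∫ t in (0 : ℝ)..1, bump δ t ≤ 1 := by
  have h := intervalIntegral.integral_mono_on (μ := volume) zero_le_one
    ((tame_bump hδ).continuous.intervalIntegrable 0 1)
    (intervalIntegrable_const (c := (1 : ℝ))) fun t _ => bump_le_one δ t
  simpa using h

/-- The data for which the dilates `φ (lam m * y)` with `H < m ≤ N` are quasi-independent: `φ` is a
periodic profile with mean `μ`, and `lam` grows by a factor `L` over gaps longer than `H`. -/
structure IsSeparated (φ : ℝ → ℝ) (lam : ℤ → ℝ) (D L μ : ℝ) (H N : ℕ) : Prop where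
  tame : Tame D φ
  nonneg : ∀ t, 0 ≤ φ t
  periodic : Function.Periodic φ 1
  mean : ∫ t in (0 : ℝ)..1, φ t = μ
  mean_nonneg : 0 ≤ μ
  mean_le_one : μ ≤ 1
  D_nonneg : 0 ≤ D
  L_pos : 0 < L
  lam_zero : lam 0 = 1
  gap : ∀ m m' : ℤ, 0 ≤ m → m + H < m' → m' ≤ N → lam m * L ≤ lam m'
  lam_nonneg : ∀ m, 0 ≤ lam m

namespace IsSeparated

variable {φ : ℝ → ℝ} {lam : ℤ → ℝ} {D L μ : ℝ} {H N : ℕ}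

theorem le_lam (S : IsSeparated φ lam D L μ H N) {m : ℤ} (h : m ∈ Finset.Ioc (H : ℤ) N) :
    L ≤ lam m := by
  have h1 := Finset.mem_Ioc.1 h
  have := S.gap 0 m le_rfl (by omega) h1.2
  rwa [S.lam_zero, one_mul] at this

theorem tame_sub (S : IsSeparated φ lam D L μ H N) : Tame D fun t => φ t - μ := by
  refine ⟨S.tame.1.sub contDiff_const, fun t => ?_, fun t => ?_⟩
  · have h1 := abs_le.1 (S.tame.2.1 t)
    have h2 := S.nonneg t
    have h3 := S.mean_nonneg
    have h4 := S.mean_le_one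
    exact abs_le.2 ⟨by linarith, by linarith⟩
  · rw [deriv_sub_const]
    exact S.tame.2.2 t

theorem tame_dilate_sub (S : IsSeparated φ lam D L μ H N) (m : ℤ) :
    Tame (D * lam m) fun y => φ (lam m * y) - μ :=
  S.tame_sub.comp_mul_left (S.lam_nonneg m)

theorem tame_dilate (S : IsSeparated φ lam D L μ H N) (m : ℤ) :
    Tame (D * lam m) fun y => φ (lam m * y) :=
  S.tame.comp_mul_left (S.lam_nonneg m)

theorem abs_integral_mul_le (S : IsSeparated φ lam D L μ H N) {G : ℝ → ℝ} {Q : ℝ} {t : ℤ}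
    (ht : t ∈ Finset.Ioc (H : ℤ) N) (hG : Tame Q G) (hQ : Q * L ≤ 3 * D * lam t) :
    |∫ y in (0 : ℝ)..1, G y * (φ (lam t * y) - μ)| ≤ (2 + 3 * D) / L := by
  have hL := S.L_pos
  have hlt := S.le_lam ht
  have hl : 0 < lam t := hL.trans_le hlt
  have hmean : ∫ s in (0 : ℝ)..1, (φ s - μ) = 0 := by
    rw [intervalIntegral.integral_sub (S.tame.continuous.intervalIntegrable _ _) (by simp), S.mean]
    simp
  have h := abs_integral_mul_comp_le (g := fun s => φ s - μ) hG S.tame_sub.continuous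
    (fun s => by simp only [S.periodic s]) S.tame_sub.2.1 hmean hl
  refine h.trans ?_
  rw [div_le_div_iff₀ hl hL]
  linarith

theorem abs_integral_le (S : IsSeparated φ lam D L μ H N) {t : ℤ}
    (ht : t ∈ Finset.Ioc (H : ℤ) N) :
    |∫ y in (0 : ℝ)..1, (φ (lam t * y) - μ)| ≤ (2 + 3 * D) / L := by
  have := S.abs_integral_mul_le ht tame_one
    (by rw [zero_mul]; exact mul_nonneg (mul_nonneg (by norm_num) S.D_nonneg) (S.lam_nonneg t))
  simpa using this

theorem error_nonneg (S : IsSeparated φ lam D L μ H N) : 0 ≤ (2 + 3 * D) / L :=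
  div_nonneg (by linarith [S.D_nonneg]) S.L_pos.le

theorem integral_dilate_le (S : IsSeparated φ lam D L μ H N) {t : ℤ}
    (ht : t ∈ Finset.Ioc (H : ℤ) N) :
    ∫ y in (0 : ℝ)..1, φ (lam t * y) ≤ μ + (2 + 3 * D) / L := by
  have h := (abs_le.1 (S.abs_integral_le ht)).2
  rw [intervalIntegral.integral_sub ((S.tame_dilate t).continuous.intervalIntegrable _ _)
    (by simp)] at h
  simp at h
  linarith

theorem integral_abs_mul_le (S : IsSeparated φ lam D L μ H N) {p t : ℤ}
    (hp : p ∈ Finset.Ioc (H : ℤ) N) (ht : t ∈ Finset.Ioc (H : ℤ) N) (hpt : p + H < t) :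
    ∫ y in (0 : ℝ)..1, |(φ (lam p * y) - μ) * (φ (lam t * y) - μ)| ≤
      4 * μ ^ 2 + 4 * ((2 + 3 * D) / L) := by
  have cφ := S.tame.continuous
  set e := (2 + 3 * D) / L with he
  have he0 : 0 ≤ e := S.error_nonneg
  have hμ0 := S.mean_nonneg
  have hμ1 := S.mean_le_one
  have h1 : ∫ y in (0 : ℝ)..1, |(φ (lam p * y) - μ) * (φ (lam t * y) - μ)| ≤
      ∫ y in (0 : ℝ)..1, (φ (lam p * y) * (φ (lam t * y) - μ) + (2 * μ) * φ (lam p * y) +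
        μ * φ (lam t * y) + μ ^ 2) := by
    refine intervalIntegral.integral_mono_on zero_le_one
      (Continuous.intervalIntegrable (by fun_prop) _ _)
      (Continuous.intervalIntegrable (by fun_prop) _ _) fun y _ => ?_
    have a1 := S.nonneg (lam p * y)
    have a2 := S.nonneg (lam t * y)
    rw [abs_le]
    constructor <;> nlinarith [mul_nonneg a1 a2, mul_nonneg a1 hμ0, mul_nonneg a2 hμ0,
      sq_nonneg μ]
  have h2 : |∫ y in (0 : ℝ)..1, φ (lam p * y) * (φ (lam t * y) - μ)| ≤ e := by
    refine S.abs_integral_mul_le ht (S.tame_dilate p) ?_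
    have g1 := S.gap p t (by have := Finset.mem_Ioc.1 hp; omega) hpt (Finset.mem_Ioc.1 ht).2
    have hD := S.D_nonneg
    have hlt := S.lam_nonneg t
    calc D * lam p * L = D * (lam p * L) := by ring
      _ ≤ D * lam t := by gcongr
      _ ≤ 3 * D * lam t := by nlinarith [mul_nonneg hD hlt]
  have h3 := S.integral_dilate_le hp
  have h4 := S.integral_dilate_le ht
  rw [intervalIntegral.integral_add (Continuous.intervalIntegrable (by fun_prop) _ _)
      (Continuous.intervalIntegrable (by fun_prop) _ _),
    intervalIntegral.integral_add (Continuous.intervalIntegrable (by fun_prop) _ _)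
      (Continuous.intervalIntegrable (by fun_prop) _ _),
    intervalIntegral.integral_add (Continuous.intervalIntegrable (by fun_prop) _ _)
      (Continuous.intervalIntegrable (by fun_prop) _ _),
    intervalIntegral.integral_const_mul, intervalIntegral.integral_const_mul] at h1
  simp only [intervalIntegral.integral_const, sub_zero, one_smul] at h1
  have h5 := (abs_le.1 h2).2
  nlinarith [mul_le_mul_of_nonneg_left h3 hμ0, mul_le_mul_of_nonneg_left h4 hμ0,
    mul_le_mul_of_nonneg_right hμ1 he0]

theorem abs_integral_mul_four_le (S : IsSeparated φ lam D L μ H N) {p q r t : ℤ}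
    (hp : p ∈ Finset.Ioc (H : ℤ) N) (hq : q ∈ Finset.Ioc (H : ℤ) N)
    (hr : r ∈ Finset.Ioc (H : ℤ) N) (ht : t ∈ Finset.Ioc (H : ℤ) N)
    (hpt : p + H < t) (hqt : q + H < t) (hrt : r + H < t) :
    |∫ y in (0 : ℝ)..1, (φ (lam p * y) - μ) * (φ (lam q * y) - μ) * (φ (lam r * y) - μ) *
      (φ (lam t * y) - μ)| ≤ (2 + 3 * D) / L := by
  refine S.abs_integral_mul_le ht
    (((S.tame_dilate_sub p).mul (S.tame_dilate_sub q)).mul (S.tame_dilate_sub r)) ?_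
  simp only [Finset.mem_Ioc] at hp hq hr ht
  have g1 := S.gap p t (by omega) hpt ht.2
  have g2 := S.gap q t (by omega) hqt ht.2
  have g3 := S.gap r t (by omega) hrt ht.2
  nlinarith [mul_le_mul_of_nonneg_left g1 S.D_nonneg, mul_le_mul_of_nonneg_left g2 S.D_nonneg,
    mul_le_mul_of_nonneg_left g3 S.D_nonneg]

end IsSeparated

/-- The centred dilates `φ (lam m * y) - μ`, restricted to `H < m ≤ N`. -/
noncomputable def centred (φ : ℝ → ℝ) (lam : ℤ → ℝ) (μ : ℝ) (H N : ℕ) (m : ℤ) (y : ℝ) : ℝ :=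
  if m ∈ Finset.Ioc (H : ℤ) N then φ (lam m * y) - μ else 0

namespace IsSeparated

variable {φ : ℝ → ℝ} {lam : ℤ → ℝ} {D L μ : ℝ} {H N : ℕ}

theorem continuous_centred (S : IsSeparated φ lam D L μ H N) (m : ℤ) :
    Continuous (centred φ lam μ H N m) := by
  unfold centred
  by_cases h : m ∈ Finset.Ioc (H : ℤ) N
  · simpa only [h, if_true] using (S.tame_dilate_sub m).continuous
  · simpa only [h, if_false] using continuous_const

theorem abs_centred_le_one (S : IsSeparated φ lam D L μ H N) (m : ℤ) (y : ℝ) :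
    |centred φ lam μ H N m y| ≤ 1 := by
  unfold centred
  split_ifs
  · exact S.tame_sub.2.1 _
  · simp

theorem integral_abs_centred_mul_le (S : IsSeparated φ lam D L μ H N) {p t : ℤ}
    (hpt : (H : ℤ) < |p - t|) :
    ∫ y in (0 : ℝ)..1, |centred φ lam μ H N p y * centred φ lam μ H N t y| ≤
      4 * μ ^ 2 + 4 * ((2 + 3 * D) / L) := by
  have hb : 0 ≤ 4 * μ ^ 2 + 4 * ((2 + 3 * D) / L) := by
    have := S.error_nonneg
    positivity
  by_cases hp : p ∈ Finset.Ioc (H : ℤ) N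
  · by_cases ht : t ∈ Finset.Ioc (H : ℤ) N
    · simp only [centred, hp, ht, if_true]
      rcases lt_or_ge p t with h | h
      · rw [abs_of_neg (by omega)] at hpt
        exact S.integral_abs_mul_le hp ht (by omega)
      · rw [abs_of_nonneg (by omega)] at hpt
        simp_rw [mul_comm (φ (lam p * _) - μ)]
        exact S.integral_abs_mul_le ht hp (by omega)
    · simpa [centred, ht] using hb
  · simpa [centred, hp] using hb

/-- Fourth-order correlations over the parallelogram `m, m + h, m', m' + h`. -/
theorem integral_centred_four_le (S : IsSeparated φ lam D L μ H N) (m m' h : ℤ) :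
    ∫ y in (0 : ℝ)..1, (centred φ lam μ H N m y * centred φ lam μ H N (m + h) y) *
      (centred φ lam μ H N m' y * centred φ lam μ H N (m' + h) y) ≤
    4 * ((2 + 3 * D) / L) +
      4 * μ ^ 2 * ((if |h| ≤ H then 1 else 0) + (if |m - m'| ≤ H then 1 else 0)) +
      (if |h| ≤ H then 1 else 0) * (if |m - m'| ≤ H then 1 else 0) := by
  have he := S.error_nonneg
  set e := (2 + 3 * D) / L with he'
  set c := centred φ lam μ H N with hc
  have c1 : ∀ m y, |c m y| ≤ 1 := S.abs_centred_le_one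
  have cc : ∀ m, Continuous (c m) := S.continuous_centred
  have two : ∀ p t, ∀ F : ℝ → ℝ, (∀ y, F y ≤ |c p y * c t y|) → Continuous F → (H : ℤ) < |p - t| →
      ∫ y in (0 : ℝ)..1, F y ≤ 4 * μ ^ 2 + 4 * e := by
    intro p t F hF hFc hpt
    refine (intervalIntegral.integral_mono_on zero_le_one (hFc.intervalIntegrable _ _)
      (Continuous.intervalIntegrable ?_ _ _) fun y _ => hF y).trans
      (S.integral_abs_centred_mul_le hpt)
    exact ((cc p).mul (cc t)).abs
  have hcont : Continuous fun y => (c m y * c (m + h) y) * (c m' y * c (m' + h) y) :=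
    ((cc _).mul (cc _)).mul ((cc _).mul (cc _))
  have prod_le : ∀ a b a' b' : ℝ, |a| ≤ 1 → |b| ≤ 1 →
      (a * b) * (a' * b') ≤ |a' * b'| := by
    intro a b a' b' ha hb
    refine (le_abs_self _).trans ?_
    rw [abs_mul]
    refine mul_le_of_le_one_left (abs_nonneg _) ?_
    rw [abs_mul]
    exact mul_le_one₀ ha (abs_nonneg _) hb
  by_cases h1 : |h| ≤ H
  · by_cases h2 : |m - m'| ≤ H
    · simp only [h1, h2, if_true]
      have : ∫ y in (0 : ℝ)..1, (c m y * c (m + h) y) * (c m' y * c (m' + h) y) ≤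
          ∫ y in (0 : ℝ)..1, (1 : ℝ) := by
        refine intervalIntegral.integral_mono_on zero_le_one (hcont.intervalIntegrable _ _)
          (by simp) fun y _ => ?_
        refine (prod_le _ _ _ _ (c1 _ _) (c1 _ _)).trans ?_
        rw [abs_mul]
        exact mul_le_one₀ (c1 _ _) (abs_nonneg _) (c1 _ _)
      simp at this
      nlinarith [sq_nonneg μ]
    · simp only [h1, h2, if_true, if_false]
      have := two m m' _ (fun y => ?_) hcont (by omega)
      · linarith
      · rw [mul_mul_mul_comm, mul_comm]
        exact prod_le _ _ _ _ (c1 _ _) (c1 _ _)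
  · have h1' : (H : ℤ) < |h| := by omega
    by_cases h2 : |m - m'| ≤ H
    · simp only [h1, h2, if_true, if_false]
      have := two m' (m' + h) _ (fun y => ?_) hcont (by rw [sub_add_cancel_left, abs_neg]; omega)
      · linarith
      · exact prod_le _ _ _ _ (c1 _ _) (c1 _ _)
    · simp only [h1, h2, if_false]
      have h2' : (H : ℤ) < |m - m'| := by omega
      suffices ∫ y in (0 : ℝ)..1, (c m y * c (m + h) y) * (c m' y * c (m' + h) y) ≤ e by linarith
      by_cases i1 : m ∈ Finset.Ioc (H : ℤ) N
      swap; · simpa [hc, centred, i1] using he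
      by_cases i2 : m + h ∈ Finset.Ioc (H : ℤ) N
      swap; · simpa [hc, centred, i2] using he
      by_cases i3 : m' ∈ Finset.Ioc (H : ℤ) N
      swap; · simpa [hc, centred, i3] using he
      by_cases i4 : m' + h ∈ Finset.Ioc (H : ℤ) N
      swap; · simpa [hc, centred, i4] using he
      simp only [hc, centred, i1, i2, i3, i4, if_true]
      have four : ∀ p q r t, p ∈ Finset.Ioc (H : ℤ) N → q ∈ Finset.Ioc (H : ℤ) N →
          r ∈ Finset.Ioc (H : ℤ) N → t ∈ Finset.Ioc (H : ℤ) N → p + H < t → q + H < t →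
          r + H < t → ∀ F : ℝ → ℝ, (∀ y, F y = (φ (lam p * y) - μ) * (φ (lam q * y) - μ) *
            (φ (lam r * y) - μ) * (φ (lam t * y) - μ)) → ∫ y in (0 : ℝ)..1, F y ≤ e := by
        intro p q r t hp hq hr ht hpt hqt hrt F hF
        rw [funext hF]
        exact (abs_le.1 (S.abs_integral_mul_four_le hp hq hr ht hpt hqt hrt)).2
      rcases lt_abs.1 h1' with g1 | g1 <;> rcases lt_abs.1 h2' with g2 | g2
      · exact four m m' (m' + h) (m + h) i1 i3 i4 i2 (by omega) (by omega) (by omega) _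
          fun y => by ring
      · exact four m m' (m + h) (m' + h) i1 i3 i2 i4 (by omega) (by omega) (by omega) _
          fun y => by ring
      · exact four (m + h) m' (m' + h) m i2 i3 i4 i1 (by omega) (by omega) (by omega) _
          fun y => by ring
      · exact four m (m + h) (m' + h) m' i1 i2 i4 i3 (by omega) (by omega) (by omega) _
          fun y => by ring

end IsSeparated

/-- The additive energy of a weight on `{1, …, N}`. -/
noncomputable def energy (N : ℕ) (x : ℤ → ℝ) : ℝ :=
  ∑ h ∈ Finset.Ioo (-N : ℤ) N, (∑ m ∈ Finset.Ioc (0 : ℤ) N, x m * x (m + h)) ^ 2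

theorem energy_nonneg (N : ℕ) (x : ℤ → ℝ) : 0 ≤ energy N x :=
  Finset.sum_nonneg fun _ _ => sq_nonneg _

theorem sum_indicator_abs_le (s : Finset ℤ) (H : ℕ) (m : ℤ) :
    ∑ m' ∈ s, (if |m - m'| ≤ (H : ℤ) then (1 : ℝ) else 0) ≤ 2 * H + 1 := by
  rw [Finset.sum_boole]
  have h1 : (s.filter fun m' => |m - m'| ≤ (H : ℤ)) ⊆ Finset.Icc (m - H) (m + H) := by
    intro u hu
    have := abs_le.1 (Finset.mem_filter.1 hu).2
    exact Finset.mem_Icc.2 ⟨by omega, by omega⟩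
  have h2 := Finset.card_le_card h1
  rw [Int.card_Icc] at h2
  have : (s.filter fun m' => |m - m'| ≤ (H : ℤ)).card ≤ 2 * H + 1 := by omega
  exact_mod_cast this

theorem IsSeparated.continuous_energy {φ : ℝ → ℝ} {lam : ℤ → ℝ} {D L μ : ℝ} {H N : ℕ}
    (S : IsSeparated φ lam D L μ H N) :
    Continuous fun y => energy N fun m => centred φ lam μ H N m y := by
  have cc := S.continuous_centred
  unfold energy
  fun_prop

theorem IsSeparated.integral_energy_le {φ : ℝ → ℝ} {lam : ℤ → ℝ} {D L μ : ℝ} {H N : ℕ}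
    (S : IsSeparated φ lam D L μ H N) :
    ∫ y in (0 : ℝ)..1, energy N (fun m => centred φ lam μ H N m y) ≤
      8 * N ^ 3 * ((2 + 3 * D) / L) + 12 * μ ^ 2 * (2 * H + 1) * N ^ 2 +
        N * (2 * H + 1) ^ 2 := by
  have he := S.error_nonneg
  set e := (2 + 3 * D) / L with he'
  set c := centred φ lam μ H N with hc
  have cc : ∀ m, Continuous (c m) := S.continuous_centred
  set I := Finset.Ioc (0 : ℤ) N with hI
  set J := Finset.Ioo (-N : ℤ) N with hJ
  have hIc : (I.card : ℝ) = N := by simp [hI]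
  have hJc : (J.card : ℝ) ≤ 2 * N := by
    have : J.card ≤ 2 * N := by simp [hJ]; omega
    exact_mod_cast this
  have h1 : ∀ y, energy N (fun m => c m y) = ∑ h ∈ J, ∑ m ∈ I, ∑ m' ∈ I,
      (c m y * c (m + h) y) * (c m' y * c (m' + h) y) := by
    intro y
    unfold energy
    refine Finset.sum_congr rfl fun h _ => ?_
    rw [sq, Finset.sum_mul_sum]
  simp_rw [h1]
  rw [intervalIntegral.integral_finsetSum fun h _ =>
    Continuous.intervalIntegrable (by fun_prop) _ _]
  have hin : ∀ h : ℤ, ∫ y in (0 : ℝ)..1, ∑ m ∈ I, ∑ m' ∈ I,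
      (c m y * c (m + h) y) * (c m' y * c (m' + h) y) ≤
      4 * e * N ^ 2 + 4 * μ ^ 2 * ((if |h| ≤ (H : ℤ) then 1 else 0) * N ^ 2 + N * (2 * H + 1)) +
        (if |h| ≤ (H : ℤ) then 1 else 0) * (N * (2 * H + 1)) := by
    intro h
    rw [intervalIntegral.integral_finsetSum fun h _ =>
      Continuous.intervalIntegrable (by fun_prop) _ _]
    set ι : ℝ := if |h| ≤ (H : ℤ) then 1 else 0 with hι
    have hι0 : 0 ≤ ι := by rw [hι]; split_ifs <;> norm_num
    have hm : ∀ m ∈ I, ∫ y in (0 : ℝ)..1, ∑ m' ∈ I,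
        (c m y * c (m + h) y) * (c m' y * c (m' + h) y) ≤
        4 * e * N + 4 * μ ^ 2 * (ι * N + (2 * H + 1)) + ι * (2 * H + 1) := by
      intro m _
      rw [intervalIntegral.integral_finsetSum fun h _ =>
        Continuous.intervalIntegrable (by fun_prop) _ _]
      refine (Finset.sum_le_sum fun m' _ => S.integral_centred_four_le m m' h).trans ?_
      simp only [← hι, ← he', Finset.sum_add_distrib, ← Finset.mul_sum, Finset.sum_const,
        nsmul_eq_mul, hIc]
      have hs := sum_indicator_abs_le I H m
      have a1 := mul_le_mul_of_nonneg_left hs hι0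
      have a2 := mul_le_mul_of_nonneg_left hs (by positivity : 0 ≤ 4 * μ ^ 2)
      linarith
    refine (Finset.sum_le_sum hm).trans (le_of_eq ?_)
    rw [Finset.sum_const, nsmul_eq_mul, hIc]
    ring
  refine (Finset.sum_le_sum fun h _ => hin h).trans ?_
  have hs : ∑ h ∈ J, (if |h| ≤ (H : ℤ) then (1 : ℝ) else 0) ≤ 2 * H + 1 := by
    simpa using sum_indicator_abs_le J H 0
  set s := ∑ h ∈ J, (if |h| ≤ (H : ℤ) then (1 : ℝ) else 0)
  calc _ = 4 * e * (J.card * N ^ 2) + 4 * μ ^ 2 * (s * N ^ 2 + J.card * (N * (2 * H + 1))) +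
        s * (N * (2 * H + 1)) := by
        simp only [Finset.sum_add_distrib, ← Finset.mul_sum, ← Finset.sum_mul, Finset.sum_const,
          nsmul_eq_mul]
        ring
    _ ≤ 4 * e * (2 * N * N ^ 2) + 4 * μ ^ 2 * ((2 * H + 1) * N ^ 2 + 2 * N * (N * (2 * H + 1))) +
        (2 * H + 1) * (N * (2 * H + 1)) := by gcongr
    _ = _ := by ring

theorem ae_exists_lt_of_tendsto_integral {Y : ℕ → ℝ → ℝ} (hc : ∀ n, Continuous (Y n))
    (h0 : ∀ n y, 0 ≤ Y n y)
    (hY : Tendsto (fun n => ∫ y in (0 : ℝ)..1, Y n y) atTop (nhds 0)) :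
    ∀ᵐ y ∂(volume.restrict (Set.Icc (0 : ℝ) 1)), ∀ ε > 0, ∀ n₀ : ℕ, ∃ n ≥ n₀, Y n y < ε := by
  set ν := volume.restrict (Set.Icc (0 : ℝ) 1) with hν
  have hint : ∀ n, Integrable (Y n) ν := fun n =>
    ((hc n).continuousOn.integrableOn_compact isCompact_Icc)
  have hI : ∀ n, ∫ y in (0 : ℝ)..1, Y n y = ∫ y, Y n y ∂ν := by
    intro n
    rw [intervalIntegral.integral_of_le zero_le_one, hν, integral_Icc_eq_integral_Ioc]
  have hlim : Tendsto (fun n => eLpNorm (Y n - 0) 1 ν) atTop (nhds 0) := by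
    have h1 : ∀ n, eLpNorm (Y n - 0) 1 ν = ENNReal.ofReal (∫ y in (0 : ℝ)..1, Y n y) := by
      intro n
      rw [sub_zero, eLpNorm_one_eq_lintegral_enorm, ← ofReal_integral_norm_eq_lintegral_enorm
        (hint n), hI]
      simp_rw [Real.norm_of_nonneg (h0 n _)]
    simp_rw [h1]
    simpa using ENNReal.tendsto_ofReal hY
  have hmeas := tendstoInMeasure_of_tendsto_eLpNorm one_ne_zero
    (fun n => (hint n).aestronglyMeasurable) aestronglyMeasurable_zero hlim
  obtain ⟨ns, hns, hae⟩ := hmeas.exists_seq_tendsto_ae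
  filter_upwards [hae] with y hy ε hε n₀
  have h1 : ∀ᶠ i in atTop, Y (ns i) y < ε := hy.eventually (gt_mem_nhds hε)
  obtain ⟨i, hi, hi'⟩ := (h1.and (hns.tendsto_atTop.eventually_ge_atTop n₀)).exists
  exact ⟨ns i, hi', hi⟩

/-- The sequence `α ^ (m ^ b)`. -/
noncomputable def expPow (α b : ℝ) (m : ℤ) : ℝ := α ^ ((m : ℝ) ^ b)

/-- The gap length `⌈N ^ (1 - b + ε)⌉`. -/
noncomputable def gapLength (b ε : ℝ) (N : ℕ) : ℕ := ⌈(N : ℝ) ^ (1 - b + ε)⌉₊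

/-- The mean of `bump δ`. -/
noncomputable def bumpMean (δ : ℝ) : ℝ := ∫ t in (0 : ℝ)..1, bump δ t

theorem rpow_add_le_rpow {b ε x z n : ℝ} (hb : 0 < b) (hb1 : b ≤ 1) (hx : 0 ≤ x)
    (hz : x + n ^ (1 - b + ε) ≤ z) (hzn : z ≤ n) (hz0 : 0 < z) :
    x ^ b + b * n ^ ε ≤ z ^ b := by
  have hn : 0 < n := hz0.trans_le hzn
  have h1 : (1 + -((z - x) / z)) ^ b ≤ 1 + b * -((z - x) / z) := by
    refine rpow_one_add_le_one_add_mul_self ?_ hb.le hb1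
    rw [neg_le_neg_iff, div_le_one hz0]
    linarith
  have h2 : 1 + -((z - x) / z) = x / z := by field_simp; ring
  rw [h2, Real.div_rpow hx hz0.le, div_le_iff₀ (Real.rpow_pos_of_pos hz0 b)] at h1
  have h3 : (z - x) / z * z ^ b = (z - x) * z ^ (b - 1) := by
    rw [Real.rpow_sub_one hz0.ne']; ring
  have h4 : n ^ (b - 1) ≤ z ^ (b - 1) :=
    Real.rpow_le_rpow_of_nonpos hz0 hzn (by linarith)
  have h5 : n ^ ε ≤ (z - x) * z ^ (b - 1) := by
    calc n ^ ε = n ^ (1 - b + ε) * n ^ (b - 1) := by rw [← Real.rpow_add hn]; congr 1; ring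
      _ ≤ (z - x) * z ^ (b - 1) := by
        have h6 := Real.rpow_nonneg hn.le (1 - b + ε)
        exact mul_le_mul (by linarith) h4 (Real.rpow_nonneg hn.le _) (by linarith)
  have h6 := mul_le_mul_of_nonneg_left h5 hb.le
  rw [← h3] at h6
  linarith

theorem isSeparated_expPow {a b α ε : ℝ} (ha : 0 ≤ a) (hb : 0 < b) (hb1 : b ≤ 1) (hα : 1 < α)
    {N : ℕ} (hN : 0 < N) :
    IsSeparated (bump ((N : ℝ) ^ (-a))) (expPow α b) (16 / ((N : ℝ) ^ (-a)) ^ 2)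
      (α ^ (b * (N : ℝ) ^ ε)) (bumpMean ((N : ℝ) ^ (-a))) (gapLength b ε N) N := by
  have hN0 : (0 : ℝ) < N := by exact_mod_cast hN
  have hN1 : (1 : ℝ) ≤ N := by exact_mod_cast hN
  have hδ : 0 < (N : ℝ) ^ (-a) := Real.rpow_pos_of_pos hN0 _
  have hδ1 : (N : ℝ) ^ (-a) ≤ 1 := Real.rpow_le_one_of_one_le_of_nonpos hN1 (by linarith)
  have hα0 : 0 < α := by linarith
  refine ⟨tame_bump hδ, bump_nonneg _, bump_periodic _, rfl,
    (by positivity : (0 : ℝ) ≤ (N : ℝ) ^ (-a) / 16).trans (le_integral_bump hδ hδ1),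
    integral_bump_le_one hδ, by positivity, Real.rpow_pos_of_pos hα0 _, ?_, ?_,
    fun m => Real.rpow_nonneg hα0.le _⟩
  · simp [expPow, Real.zero_rpow hb.ne']
  · intro m m' hm hgap hm'
    unfold expPow
    rw [← Real.rpow_add hα0, Real.rpow_le_rpow_left_iff hα]
    have hm0 : (0 : ℝ) ≤ m := by exact_mod_cast hm
    have hg : (m : ℝ) + gapLength b ε N < m' := by exact_mod_cast hgap
    have hg1 : (N : ℝ) ^ (1 - b + ε) ≤ gapLength b ε N := Nat.le_ceil _
    have hg2 := Real.rpow_pos_of_pos hN0 (1 - b + ε)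
    exact rpow_add_le_rpow hb hb1 hm0 (by linarith) (by exact_mod_cast hm') (by linarith)

/-- The energy of the centred weight, normalised by the size of the main term. -/
noncomputable def relEnergy (a b α ε : ℝ) (N : ℕ) (y : ℝ) : ℝ :=
  N * energy N (fun m => centred (bump ((N : ℝ) ^ (-a))) (expPow α b)
    (bumpMean ((N : ℝ) ^ (-a))) (gapLength b ε N) N m y) / (bumpMean ((N : ℝ) ^ (-a)) * N) ^ 4

theorem relEnergy_nonneg (a b α ε : ℝ) (N : ℕ) (y : ℝ) : 0 ≤ relEnergy a b α ε N y :=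
  div_nonneg (mul_nonneg (Nat.cast_nonneg _) (energy_nonneg _ _)) (Even.pow_nonneg (by decide) _)

theorem bumpMean_lower {a : ℝ} (ha : 0 ≤ a) {N : ℕ} (hN : 0 < N) :
    (N : ℝ) ^ (-a) / 16 ≤ bumpMean ((N : ℝ) ^ (-a)) := by
  have hN0 : (0 : ℝ) < N := by exact_mod_cast hN
  have hN1 : (1 : ℝ) ≤ N := by exact_mod_cast hN
  exact le_integral_bump (Real.rpow_pos_of_pos hN0 _)
    (Real.rpow_le_one_of_one_le_of_nonpos hN1 (by linarith))

theorem bumpMean_pos {a : ℝ} (ha : 0 ≤ a) {N : ℕ} (hN : 0 < N) :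
    0 < bumpMean ((N : ℝ) ^ (-a)) := by
  have hN0 : (0 : ℝ) < N := by exact_mod_cast hN
  have := Real.rpow_pos_of_pos hN0 (-a)
  linarith [bumpMean_lower ha hN]

theorem inv_bumpMean_le {a : ℝ} (ha : 0 ≤ a) {N : ℕ} (hN : 0 < N) :
    (bumpMean ((N : ℝ) ^ (-a)))⁻¹ ≤ 16 * (N : ℝ) ^ a := by
  have hN0 : (0 : ℝ) < N := by exact_mod_cast hN
  have hp := Real.rpow_pos_of_pos hN0 a
  have h := bumpMean_lower ha hN
  rw [inv_le_comm₀ (bumpMean_pos ha hN) (by positivity)]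
  refine le_trans (le_of_eq ?_) h
  rw [Real.rpow_neg hN0.le]
  field_simp

/-- The proportion of gaps of length at most `gapLength b ε N`, relative to the squared mean. -/
noncomputable def gapRatio (a b ε : ℝ) (N : ℕ) : ℝ :=
  (2 * gapLength b ε N + 1) / (N * bumpMean ((N : ℝ) ^ (-a)) ^ 2)

theorem gapRatio_le {a b ε : ℝ} (ha : 0 ≤ a) (hε : 0 ≤ ε) (hb1 : b ≤ 1) {N : ℕ} (hN : 0 < N) :
    gapRatio a b ε N ≤ 1280 * (N : ℝ) ^ (2 * a - b + ε) := by
  have hN0 : (0 : ℝ) < N := by exact_mod_cast hN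
  have hN1 : (1 : ℝ) ≤ N := by exact_mod_cast hN
  have hi := inv_bumpMean_le ha hN
  have hμ := bumpMean_pos ha hN
  have hH : (gapLength b ε N : ℝ) ≤ (N : ℝ) ^ (1 - b + ε) + 1 :=
    (Nat.ceil_lt_add_one (Real.rpow_nonneg hN0.le _)).le
  have hone : (1 : ℝ) ≤ (N : ℝ) ^ (1 - b + ε) := Real.one_le_rpow hN1 (by linarith)
  have h0 : 0 < (bumpMean ((N : ℝ) ^ (-a)))⁻¹ := inv_pos.2 hμ
  calc gapRatio a b ε N
      = (2 * gapLength b ε N + 1) * (N : ℝ)⁻¹ * ((bumpMean ((N : ℝ) ^ (-a)))⁻¹) ^ 2 := by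
        unfold gapRatio; field_simp
    _ ≤ (5 * (N : ℝ) ^ (1 - b + ε)) * (N : ℝ)⁻¹ * (16 * (N : ℝ) ^ a) ^ 2 := by
        gcongr
        linarith
    _ = 1280 * ((N : ℝ) ^ (1 - b + ε) * (N : ℝ) ^ (-1 : ℝ) * ((N : ℝ) ^ a * (N : ℝ) ^ a)) := by
        rw [Real.rpow_neg_one]; ring
    _ = _ := by
        rw [← Real.rpow_add hN0, ← Real.rpow_add hN0, ← Real.rpow_add hN0]
        congr 2
        ring

theorem gapRatio_nonneg (a b ε : ℝ) (N : ℕ) : 0 ≤ gapRatio a b ε N := by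
  unfold gapRatio; positivity

theorem tendsto_gapRatio {a b ε : ℝ} (ha : 0 ≤ a) (hε : 0 ≤ ε) (hb1 : b ≤ 1)
    (h : 2 * a - b + ε < 0) : Tendsto (gapRatio a b ε) atTop (nhds 0) := by
  have h1 : Tendsto (fun N : ℕ => 1280 * (N : ℝ) ^ (2 * a - b + ε)) atTop (nhds 0) := by
    have := ((tendsto_rpow_neg_atTop (y := -(2 * a - b + ε)) (by linarith)).comp
      tendsto_natCast_atTop_atTop).const_mul (1280 : ℝ)
    simpa [Function.comp_def] using this
  refine squeeze_zero' (Eventually.of_forall fun N => gapRatio_nonneg a b ε N) ?_ h1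
  filter_upwards [eventually_gt_atTop 0] with N hN
  exact gapRatio_le ha hε hb1 hN

theorem integral_relEnergy_le {a b α ε : ℝ} (ha : 0 ≤ a) (hb : 0 < b) (hb1 : b ≤ 1)
    (hα : 1 < α) {N : ℕ} (hN : 0 < N) :
    ∫ y in (0 : ℝ)..1, relEnergy a b α ε N y ≤
      8 * 16 ^ 4 * 50 * ((N : ℝ) ^ (6 * a) * Real.exp (-(b * Real.log α) * (N : ℝ) ^ ε)) +
        12 * gapRatio a b ε N + gapRatio a b ε N ^ 2 := by
  have hN0 : (0 : ℝ) < N := by exact_mod_cast hN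
  have hN1 : (1 : ℝ) ≤ N := by exact_mod_cast hN
  have S := isSeparated_expPow (ε := ε) ha hb hb1 hα hN
  have hE := S.integral_energy_le
  have hi := inv_bumpMean_le ha hN
  have hμ := bumpMean_pos ha hN
  unfold relEnergy gapRatio
  rw [intervalIntegral.integral_div, intervalIntegral.integral_const_mul]
  set μ := bumpMean ((N : ℝ) ^ (-a))
  set H := gapLength b ε N
  set δ := (N : ℝ) ^ (-a) with hδ
  set L := α ^ (b * (N : ℝ) ^ ε) with hLdef
  have hL : L⁻¹ = Real.exp (-(b * Real.log α) * (N : ℝ) ^ ε) := by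
    rw [hLdef, Real.rpow_def_of_pos (by linarith), ← Real.exp_neg]
    congr 1; ring
  have hLpos : 0 < L := S.L_pos
  have hD : 2 + 3 * (16 / δ ^ 2) ≤ 50 * (N : ℝ) ^ (2 * a) := by
    have h1 : 16 / δ ^ 2 = 16 * (N : ℝ) ^ (2 * a) := by
      rw [hδ, ← Real.rpow_natCast, ← Real.rpow_mul hN0.le, div_eq_mul_inv, ← Real.rpow_neg hN0.le]
      congr 2; push_cast; ring
    have h2 : (1 : ℝ) ≤ (N : ℝ) ^ (2 * a) := Real.one_le_rpow hN1 (by linarith)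
    rw [h1]; linarith
  have hpow : (N : ℝ) ^ (6 * a) = ((N : ℝ) ^ a) ^ 4 * (N : ℝ) ^ (2 * a) := by
    rw [← Real.rpow_natCast, ← Real.rpow_mul hN0.le, ← Real.rpow_add hN0]
    congr 1; push_cast; ring
  calc _ ≤ N * (8 * N ^ 3 * ((2 + 3 * (16 / δ ^ 2)) / L) + 12 * μ ^ 2 * (2 * H + 1) * N ^ 2 +
        N * (2 * H + 1) ^ 2) / (μ * N) ^ 4 := by gcongr
    _ = 8 * ((2 + 3 * (16 / δ ^ 2)) * L⁻¹) * (μ⁻¹) ^ 4 + 12 * ((2 * H + 1) / (N * μ ^ 2)) +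
        ((2 * H + 1) / (N * μ ^ 2)) ^ 2 := by
        generalize 16 / δ ^ 2 = D
        field_simp
    _ ≤ 8 * ((50 * (N : ℝ) ^ (2 * a)) * L⁻¹) * (16 * (N : ℝ) ^ a) ^ 4 +
        12 * ((2 * H + 1) / (N * μ ^ 2)) + ((2 * H + 1) / (N * μ ^ 2)) ^ 2 := by
        gcongr
    _ = _ := by rw [hpow, ← hL]; ring

theorem tendsto_rpow_mul_exp_neg_rpow {s c ε : ℝ} (hc : 0 < c) (hε : 0 < ε) :
    Tendsto (fun N : ℕ => (N : ℝ) ^ s * Real.exp (-c * (N : ℝ) ^ ε)) atTop (nhds 0) := by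
  have h1 := (tendsto_rpow_mul_exp_neg_mul_atTop_nhds_zero (s / ε) c hc).comp
    ((tendsto_rpow_atTop hε).comp tendsto_natCast_atTop_atTop)
  refine h1.congr fun N => ?_
  simp only [Function.comp_apply]
  rw [← Real.rpow_mul (Nat.cast_nonneg _), mul_div_cancel₀ _ hε.ne']

theorem tendsto_integral_relEnergy {a b α ε : ℝ} (ha : 0 ≤ a) (hb : 0 < b) (hb1 : b ≤ 1)
    (hα : 1 < α) (hε : 0 < ε) (h : 2 * a - b + ε < 0) :
    Tendsto (fun N : ℕ => ∫ y in (0 : ℝ)..1, relEnergy a b α ε N y) atTop (nhds 0) := by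
  have h1 := tendsto_rpow_mul_exp_neg_rpow (s := 6 * a) (mul_pos hb (Real.log_pos hα)) hε
  have h2 := tendsto_gapRatio ha hε.le hb1 h
  have h3 := ((h1.const_mul (8 * 16 ^ 4 * 50)).add (h2.const_mul 12)).add (h2.pow 2)
  norm_num only [] at h3
  refine squeeze_zero' (Eventually.of_forall fun N => ?_) ?_ h3
  · exact intervalIntegral.integral_nonneg zero_le_one fun y _ => relEnergy_nonneg _ _ _ _ _ _
  · filter_upwards [eventually_gt_atTop 0] with N hN
    have := integral_relEnergy_le (ε := ε) ha hb hb1 hα hN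
    norm_num only [] at this
    exact this

theorem ae_exists_relEnergy_lt {a b α ε : ℝ} (ha : 0 ≤ a) (hb : 0 < b) (hb1 : b ≤ 1)
    (hα : 1 < α) (hε : 0 < ε) (h : 2 * a - b + ε < 0) :
    ∀ᵐ y ∂(volume.restrict (Set.Icc (0 : ℝ) 1)), ∀ η > 0, ∀ N₀ : ℕ, ∃ N ≥ N₀,
      relEnergy a b α ε N y < η := by
  have hc : ∀ n : ℕ, Continuous (relEnergy a b α ε (n + 1)) := by
    intro n
    have := (isSeparated_expPow (ε := ε) ha hb hb1 hα n.succ_pos).continuous_energy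
    exact (this.const_mul _).div_const _
  filter_upwards [ae_exists_lt_of_tendsto_integral hc (fun n y => relEnergy_nonneg _ _ _ _ _ _)
    ((tendsto_integral_relEnergy ha hb hb1 hα hε h).comp (tendsto_add_atTop_nat 1))]
    with y hy η hη N₀
  obtain ⟨n, hn, hn'⟩ := hy η hη N₀
  exact ⟨n + 1, by omega, hn'⟩

/-- A set of positive upper Banach density contains, beyond any given point, a finite set of
integers of positive density in some long interval. -/
theorem exists_finset_of_density {A : Set ℕ} {d : ℝ} (hd : 0 < d)
    (hA : ∀ N₀ : ℕ, ∃ k N : ℕ, N₀ ≤ N ∧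
      d * (N : ℝ) ≤ ((A ∩ Set.Ioc k (k + N)).ncard : ℝ)) (K N : ℕ) (hN : 0 < N) :
    ∃ (B : Finset ℤ) (k M : ℕ), (∀ u ∈ B, ∃ n : ℕ, u = n ∧ n ∈ A ∧ K ≤ n) ∧ N ≤ M ∧
      B ⊆ Finset.Ioc (k : ℤ) (k + M) ∧ d / 2 * M ≤ B.card ∧ 0 < B.card := by
  classical
  obtain ⟨m₀, hm₀⟩ := exists_nat_gt (2 * K / d)
  obtain ⟨k, M, hM, hcard⟩ := hA (max N m₀)
  set B₀ : Finset ℕ := (Finset.Ioc k (k + M)).filter (· ∈ A) with hB₀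
  have h1 : ((A ∩ Set.Ioc k (k + M)).ncard) = B₀.card := by
    rw [← Set.ncard_coe_finset]
    congr 1
    ext n
    simp [hB₀, and_comm]
  set B₁ := B₀ \ Finset.range K with hB₁
  have h2 : B₀.card ≤ B₁.card + K := by
    have : B₀.card - (Finset.range K).card ≤ B₁.card := Finset.le_card_sdiff _ _
    rw [Finset.card_range] at this
    omega
  have hMN : N ≤ M := (le_max_left _ _).trans hM
  have hMm : (m₀ : ℝ) ≤ M := by exact_mod_cast (le_max_right _ _).trans hM
  have h3 : 2 * (K : ℝ) ≤ d * M := by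
    have := (div_lt_iff₀ hd).1 hm₀
    nlinarith
  have h4 : d / 2 * M ≤ B₁.card := by
    rw [h1] at hcard
    have : (B₀.card : ℝ) ≤ B₁.card + K := by exact_mod_cast h2
    linarith
  have hM0 : (0 : ℝ) < M := by exact_mod_cast hN.trans_le hMN
  refine ⟨B₁.map Nat.castEmbedding, k, M, ?_, hMN, ?_, ?_, ?_⟩
  · intro u hu
    obtain ⟨n, hn, rfl⟩ := Finset.mem_map.1 hu
    simp only [hB₁, hB₀, Finset.mem_sdiff, Finset.mem_filter, Finset.mem_range, not_lt] at hn
    exact ⟨n, rfl, hn.1.2, hn.2⟩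
  · intro u hu
    obtain ⟨n, hn, rfl⟩ := Finset.mem_map.1 hu
    simp only [hB₁, hB₀, Finset.mem_sdiff, Finset.mem_filter, Finset.mem_Ioc] at hn
    simp only [Nat.castEmbedding_apply, Finset.mem_Ioc]
    omega
  · rwa [Finset.card_map]
  · rw [Finset.card_map]
    have : (0 : ℝ) < B₁.card := lt_of_lt_of_le (by positivity) h4
    exact_mod_cast this

/-- If no difference `m ∈ (H, N]` of `B` has `φ (lam m * y) ≠ 0`, then the energy of the centred
weight is large. -/
theorem le_energy_of_forall_corr {φ : ℝ → ℝ} {lam : ℤ → ℝ} {μ d y : ℝ} {H M N : ℕ} {k : ℤ}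
    {B : Finset ℤ} (hμ : 0 ≤ μ) (hN : 0 < N) (hNM : N ≤ M) (hB : B ⊆ Finset.Ioc k (k + M))
    (hB0 : 0 < B.card) (hd : 0 ≤ d) (hBd : d * M ≤ B.card) (hH : (2 * H + 1) / N ≤ d / 6)
    (hzero : ∀ m ∈ Finset.Ioc (H : ℤ) N, φ (lam m * y) = 0 ∨ corr B m = 0) :
    (μ * (d * N / 12)) ^ 4 ≤ 2 * N * energy N fun m => centred φ lam μ H N m y := by
  have hN0 : (0 : ℝ) < N := by exact_mod_cast hN
  have hB0' : (0 : ℝ) < B.card := by exact_mod_cast hB0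
  have hHN : (2 * H + 1 : ℝ) ≤ d * N / 6 := by
    rw [div_le_iff₀ hN0] at hH
    linarith
  have hsub : Finset.Ioc (H : ℤ) N ⊆ Finset.Ioc (0 : ℤ) N :=
    Finset.Ioc_subset_Ioc_left (by omega)
  have hsplit : ∑ m ∈ Finset.Ioc (0 : ℤ) N, corr B m ≤
      H * B.card + ∑ m ∈ Finset.Ioc (H : ℤ) N, corr B m := by
    have hcover : Finset.Ioc (0 : ℤ) N ⊆ Finset.Ioc (0 : ℤ) H ∪ Finset.Ioc (H : ℤ) N := by
      intro m hm
      simp only [Finset.mem_union, Finset.mem_Ioc] at *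
      omega
    refine (Finset.sum_le_sum_of_subset_of_nonneg hcover fun m _ _ => corr_nonneg B m).trans ?_
    have hdisj : Disjoint (Finset.Ioc (0 : ℤ) H) (Finset.Ioc (H : ℤ) N) := by
      rw [Finset.disjoint_left]
      intro m hm hm'
      simp only [Finset.mem_Ioc] at *
      omega
    rw [Finset.sum_union hdisj]
    have := Finset.sum_le_card_nsmul (Finset.Ioc (0 : ℤ) H) (corr B) B.card
      fun m _ => corr_le_card B m
    simp only [Int.card_Ioc, sub_zero, Int.toNat_natCast, nsmul_eq_mul] at this
    linarith
  have hlow := card_mul_le_card_add_sum_corr B k M N d hN hNM hB hBd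
  set V := ∑ m ∈ Finset.Ioc (H : ℤ) N, corr B m with hV
  have hVlow : B.card * (d * N / 12) ≤ V := by
    nlinarith [mul_le_mul_of_nonneg_left hHN hB0'.le]
  have hsum : ∑ m ∈ Finset.Ioc (0 : ℤ) N, centred φ lam μ H N m y * corr B m = -(μ * V) := by
    rw [← Finset.sum_subset hsub, hV, Finset.mul_sum, ← Finset.sum_neg_distrib]
    · refine Finset.sum_congr rfl fun m hm => ?_
      rcases hzero m hm with h | h
      · simp only [centred, hm, if_true, h]; ring
      · simp [h]
    · intro m _ hm
      simp [centred, hm]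
  have h4 := sum_mul_corr_pow_four_le B N (fun m => centred φ lam μ H N m y) fun m hm => by
    have : m ∉ Finset.Ioc (H : ℤ) N := fun h => hm (hsub h)
    simp [centred, this]
  rw [hsum] at h4
  have h5 : ((B.card : ℝ) * (μ * (d * N / 12))) ^ 4 ≤ (-(μ * V)) ^ 4 := by
    rw [Even.neg_pow (by decide)]
    refine pow_le_pow_left₀ (by positivity) ?_ 4
    have := mul_le_mul_of_nonneg_left hVlow hμ
    linarith
  have h6 := h5.trans h4
  rw [mul_pow] at h6
  exact le_of_mul_le_mul_left h6 (by positivity)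

/-- for `0 < 2a < b ≤ 1` and `α > 1`, for a.e. `y ∈ [0,1]`: every
`A ⊆ ℕ` of positive upper Banach density admits infinitely many pairs `(n,m)`
with `⟨α^{m^b} y⟩ < m^{-a}`, `n ∈ A` and `n + m ∈ A`. -/
theorem intersective_corollary (a b α : ℝ) (ha : 0 < a) (hab : 2 * a < b)
    (hb1 : b ≤ 1) (hα : 1 < α) :
    ∀ᵐ y ∂(volume.restrict (Set.Icc (0:ℝ) 1)),
      ∀ A : Set ℕ,
        (∃ d : ℝ, 0 < d ∧ ∀ N₀ : ℕ, ∃ k N : ℕ, N₀ ≤ N ∧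
          d * (N:ℝ) ≤ ((A ∩ Set.Ioc k (k + N)).ncard : ℝ)) →
        {p : ℕ × ℕ |
          distNearestInt (α ^ ((p.2:ℝ) ^ b) * y) < (p.2:ℝ) ^ (-a) ∧
          p.1 ∈ A ∧ p.1 + p.2 ∈ A}.Infinite := by
  have hb : 0 < b := by linarith
  obtain ⟨ε, hε, hε'⟩ : ∃ ε : ℝ, 0 < ε ∧ 2 * a - b + ε < 0 :=
    ⟨(b - 2 * a) / 2, by linarith, by linarith⟩
  filter_upwards [ae_exists_relEnergy_lt ha.le hb hb1 hα hε hε'] with y hy A ⟨d, hd, hA⟩ hfin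
  obtain ⟨K, hK⟩ := (hfin.image Prod.fst).bddAbove
  set c := d / 2 with hc
  have hc0 : 0 < c := by positivity
  obtain ⟨N₁, hN₁⟩ := eventually_atTop.1 ((tendsto_gapRatio ha.le hε.le hb1 hε').eventually
    (gt_mem_nhds (show 0 < c / 6 by positivity)))
  obtain ⟨N, hN, hNlt⟩ := hy ((c / 12) ^ 4 / 2) (by positivity) (max N₁ 1)
  have hN0 : 0 < N := (le_max_right _ _).trans hN
  have hN0' : (0 : ℝ) < N := by exact_mod_cast hN0
  obtain ⟨B, k, M, hBA, hNM, hB, hBd, hB0⟩ := exists_finset_of_density hd hA (K + 1) N hN0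
  have S := isSeparated_expPow (ε := ε) ha.le hb hb1 hα hN0
  have hμ := bumpMean_pos ha.le hN0
  have hδ : 0 < (N : ℝ) ^ (-a) := Real.rpow_pos_of_pos hN0' _
  have hgap : (2 * gapLength b ε N + 1 : ℝ) / N ≤ c / 6 := by
    refine le_trans ?_ (hN₁ N ((le_max_left _ _).trans hN)).le
    unfold gapRatio
    refine div_le_div_of_nonneg_left (by positivity) (by positivity) ?_
    exact mul_le_of_le_one_right hN0'.le (pow_le_one₀ hμ.le S.mean_le_one)
  have hzero : ∀ m ∈ Finset.Ioc (gapLength b ε N : ℤ) N,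
      bump ((N : ℝ) ^ (-a)) (expPow α b m * y) = 0 ∨ corr B m = 0 := by
    intro m hm
    by_contra! hne
    obtain ⟨h1, h2⟩ := hne
    have h3 := distNearestInt_lt_of_bump_ne_zero hδ h1
    unfold corr at h2
    obtain ⟨u, hu⟩ := Finset.card_ne_zero.1 (fun h => h2 (by rw [h, Nat.cast_zero]))
    obtain ⟨hu1, hu2⟩ := Finset.mem_filter.1 hu
    obtain ⟨n, rfl, hnA, hnK⟩ := hBA u hu1
    obtain ⟨n', hn', hnA', -⟩ := hBA _ hu2
    have hm' := Finset.mem_Ioc.1 hm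
    lift m to ℕ using by omega
    have hm0 : 0 < m := by omega
    have h4 : n' = n + m := by omega
    have h5 : (N : ℝ) ^ (-a) ≤ (m : ℝ) ^ (-a) :=
      Real.rpow_le_rpow_of_nonpos (by exact_mod_cast hm0)
        (by exact_mod_cast hm'.2) (by linarith)
    have hmem : n ≤ K := hK ⟨(n, m), ⟨h3.trans_le h5, hnA, h4 ▸ hnA'⟩, rfl⟩
    omega
  have hmain := le_energy_of_forall_corr hμ.le hN0 hNM hB hB0 hc0.le hBd hgap hzero
  unfold relEnergy at hNlt
  rw [div_lt_iff₀ (by positivity)] at hNlt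
  have : (c / 12) ^ 4 * (bumpMean ((N : ℝ) ^ (-a)) * N) ^ 4 =
    (bumpMean ((N : ℝ) ^ (-a)) * (c * N / 12)) ^ 4 := by ring
  linarith
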